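/- For all z, γ ∈ ℂ and λ ∈ ℂ^N at which both matrices are defined (all theta-function denominators nonzero), the elliptic dynamical R-matrix is unitary: R(z,λ) ∘ (P R(−z,λ) P) = Id on ℂ^N ⊗ ℂ^N, where P is the flip u⊗v ↦ v⊗u; i.e. R(z,λ) R(−z,λ)^{(21)} = Id. -/

import Mathlib

open scoped BigOperators
open Complex Matrix Filter Topology

noncomputable section

namespace EllipticQG

/-- Jacobi's first theta function `θ(z) = -∑_{j ∈ ℤ+1/2} e^{πij²τ + 2πij(z+1/2)}`. -/
def theta (τ z : ℂ) : ℂ :=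
  -∑' j : ℤ, Complex.exp ((Real.pi : ℂ) * Complex.I * ((j : ℂ) + 1 / 2) ^ 2 * τ +
      2 * (Real.pi : ℂ) * Complex.I * ((j : ℂ) + 1 / 2) * (z + 1 / 2))

/-- `α(z,μ) = θ(z)θ(μ+γ)/(θ(z-γ)θ(μ))`. -/
def alphaF (τ γ z μ : ℂ) : ℂ :=
  theta τ z * theta τ (μ + γ) / (theta τ (z - γ) * theta τ μ)

/-- `β(z,μ) = -θ(z+μ)θ(γ)/(θ(z-γ)θ(μ))`. -/
def betaF (τ γ z μ : ℂ) : ℂ :=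
  -(theta τ (z + μ) * theta τ γ) / (theta τ (z - γ) * theta τ μ)

/-- The elliptic dynamical R-matrix of `E_{τ,γ/2}(gl_N)` on `ℂ^N ⊗ ℂ^N`.
Entry `((i,j),(k,l))` is the coefficient of `e_i ⊗ e_j` in `R (e_k ⊗ e_l)`. -/
def Rmat (N : ℕ) (τ γ z : ℂ) (lam : Fin N → ℂ) :
    Matrix (Fin N × Fin N) (Fin N × Fin N) ℂ := fun p q =>
  if p.1 = p.2 then (if q = p then 1 else 0)
  else (if q = p then alphaF τ γ z (lam p.1 - lam p.2) else 0) +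
    (if q = (p.2, p.1) then betaF τ γ z (lam p.1 - lam p.2) else 0)

/-- `λ - γ ∑_{c ∈ S} h^{(c)}` evaluated on the configuration `g` of basis indices. -/
def shiftL {n N : ℕ} (γ : ℂ) (lam : Fin N → ℂ) (S : Finset (Fin n)) (g : Fin n → Fin N) :
    Fin N → ℂ :=
  fun i => lam i - γ * ((S.filter fun c => g c = i).card : ℂ)

/-- `R(z, λ - γ ∑_{c∈S} h^{(c)})^{(a b)}` acting on `(ℂ^N)^{⊗ n}`. -/
def Rop (N n : ℕ) (τ γ z : ℂ) (lam : Fin N → ℂ) (S : Finset (Fin n)) (a b : Fin n) :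
    Matrix (Fin n → Fin N) (Fin n → Fin N) ℂ := fun f g =>
  if ∀ c, c ≠ a → c ≠ b → f c = g c then
    Rmat N τ γ z (shiftL γ lam S g) (f a, f b) (g a, g b)
  else 0

/-- The operators `W_n(z,λ)`, defined recursively:  `W_1 = 1` and
`W_{n+1}(z,λ) = R(z_1-z_2, λ-γ∑_{j=3}^{n+1}h^{(j)})^{(12)} ⋯ R(z_1-z_{n+1},λ)^{(1 n+1)}
  (1 ⊗ W_n(z_2,…,z_{n+1}, λ-γh^{(1)}))` (tensor factors indexed `0,…,n`). -/
def Wrec (N : ℕ) (τ γ : ℂ) : (n : ℕ) → (Fin n → ℂ) → (Fin N → ℂ) →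
    Matrix (Fin n → Fin N) (Fin n → Fin N) ℂ
  | 0, _, _ => 1
  | n + 1, z, lam =>
    (((List.finRange n).map fun j : Fin n =>
      Rop N (n + 1) τ γ (z 0 - z j.succ) lam
        (Finset.univ.filter fun c : Fin (n + 1) => j.succ < c) 0 j.succ).prod) *
      Matrix.of (fun f g : Fin (n + 1) → Fin N =>
        if f 0 = g 0 then
          Wrec N τ γ n (fun j => z j.succ) (fun i => lam i - if g 0 = i then γ else 0)
            (Fin.tail f) (Fin.tail g)
        else 0)

/-- `W^S_n(λ) = W_n(z^S, λ)` with `z^S = (0, γ, 2γ, …, (n-1)γ)`. -/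
def WS (N n : ℕ) (τ γ : ℂ) (lam : Fin N → ℂ) :
    Matrix (Fin n → Fin N) (Fin n → Fin N) ℂ :=
  Wrec N τ γ n (fun j => ((j : ℕ) : ℂ) * γ) lam

/-- `z^∧ = ((n-1)γ, …, 2γ, γ, 0)`. -/
def zWedge (n : ℕ) (γ : ℂ) : Fin n → ℂ := fun j => ((n - 1 - (j : ℕ) : ℕ) : ℂ) * γ

/-- `W^∧_n(λ) = lim_{z → z^∧} ∏_{j=1}^{n-1} (z_j - z_{j+1} - γ) · ρ W_n(z,λ) ρ`,
where `ρ` reverses the order of the tensor factors. -/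
def Wwedge (N n : ℕ) (τ γ : ℂ) (lam : Fin N → ℂ) :
    Matrix (Fin n → Fin N) (Fin n → Fin N) ℂ :=
  limUnder (𝓝[≠] zWedge n γ) fun z : Fin n → ℂ =>
    (∏ j : Fin n, if h : (j : ℕ) + 1 < n then z j - z ⟨(j : ℕ) + 1, h⟩ - γ else 1) •
      Matrix.of fun f g : Fin n → Fin N => Wrec N τ γ n z lam (f ∘ Fin.rev) (g ∘ Fin.rev)

/-- The space `S²(ℂ^N)` of symmetric tensors in `ℂ^N ⊗ ℂ^N`. -/
def symPair (N : ℕ) : Submodule ℂ ((Fin N × Fin N) → ℂ) where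
  carrier := {v | ∀ p : Fin N × Fin N, v p = v (p.2, p.1)}
  add_mem' := by intro a b ha hb p; simp only [Pi.add_apply, ha p, hb p]
  zero_mem' := by intro p; rfl
  smul_mem' := by intro c v hv p; simp only [Pi.smul_apply, hv p]

/-- `R^{reg}(γ,λ) = lim_{z→γ} (z-γ) R(z,λ)`. -/
def Rreg (N : ℕ) (τ γ : ℂ) (lam : Fin N → ℂ) : Matrix (Fin N × Fin N) (Fin N × Fin N) ℂ :=
  limUnder (𝓝[≠] γ) fun z : ℂ => (z - γ) • Rmat N τ γ z lam

/-- The flip `P : u ⊗ v ↦ v ⊗ u` on `ℂ^N ⊗ ℂ^N`. -/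
def Pmat (N : ℕ) : Matrix (Fin N × Fin N) (Fin N × Fin N) ℂ := fun p q =>
  if q = (p.2, p.1) then 1 else 0

/-- The space `S^n(ℂ^N)` of symmetric tensors in `(ℂ^N)^{⊗n}`. -/
def symTensors (N n : ℕ) : Submodule ℂ ((Fin n → Fin N) → ℂ) where
  carrier := {v | ∀ (σ : Equiv.Perm (Fin n)) (f : Fin n → Fin N), v (f ∘ σ) = v f}
  add_mem' := by intro a b ha hb σ f; simp only [Pi.add_apply, ha σ f, hb σ f]
  zero_mem' := by intro σ f; rfl
  smul_mem' := by intro c v hv σ f; simp only [Pi.smul_apply, hv σ f]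

/-- `J_n(ℂ^N)`: the span of tensors `σ v - sign(σ) v`. -/
def Jspan (N n : ℕ) : Submodule ℂ ((Fin n → Fin N) → ℂ) :=
  Submodule.span ℂ {w | ∃ (σ : Equiv.Perm (Fin n)) (v : (Fin n → Fin N) → ℂ),
    w = (fun f => v (f ∘ σ)) - ((Equiv.Perm.sign σ : ℤ) : ℂ) • v}

/-- `ℂ^N ⊗ W ⊆ ℂ^N ⊗ (ℂ^N)^{⊗ n}` for a subspace `W ⊆ (ℂ^N)^{⊗ n}`. -/
def consSlice (N n : ℕ) (W : Submodule ℂ ((Fin n → Fin N) → ℂ)) :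
    Submodule ℂ ((Fin (n + 1) → Fin N) → ℂ) where
  carrier := {v | ∀ i : Fin N, (fun g : Fin n → Fin N => v (Fin.cons i g)) ∈ W}
  add_mem' := by intro a b ha hb i; exact W.add_mem (ha i) (hb i)
  zero_mem' := by intro i; exact W.zero_mem
  smul_mem' := by intro c v hv i; exact W.smul_mem c (hv i)

/-- The `L`-operator of `V^{⊗n}(w)`:
`L(z,λ) = R(z-w, λ-γ∑_{j=2}^n h^{(j)})^{(01)} ⋯ R(z-w-γ(n-1), λ)^{(0n)}`,
acting on `ℂ^N ⊗ (ℂ^N)^{⊗n}` with factors numbered `0,…,n`. -/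
def Lop (N n : ℕ) (τ γ z w : ℂ) (lam : Fin N → ℂ) :
    Matrix (Fin (n + 1) → Fin N) (Fin (n + 1) → Fin N) ℂ :=
  ((List.finRange n).map fun j : Fin n =>
    Rop N (n + 1) τ γ (z - w - (j : ℕ) * γ) lam
      (Finset.univ.filter fun c : Fin (n + 1) => j.succ < c) 0 j.succ).prod

/-- The `L`-operator for the opposite coproduct:
`L'(z,λ) = R(z-w-γ(n-1), λ-γ∑_{j=1}^{n-1} h^{(j)})^{(0n)} ⋯ R(z-w, λ)^{(01)}`. -/
def Lop' (N n : ℕ) (τ γ z w : ℂ) (lam : Fin N → ℂ) :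
    Matrix (Fin (n + 1) → Fin N) (Fin (n + 1) → Fin N) ℂ :=
  (((List.finRange n).reverse).map fun j : Fin n =>
    Rop N (n + 1) τ γ (z - w - (j : ℕ) * γ) lam
      (Finset.univ.filter fun c : Fin (n + 1) => 0 < c ∧ c < j.succ) 0 j.succ).prod

/-- `Id ⊗ M` on `ℂ^N ⊗ (ℂ^N)^{⊗n}`. -/
def idTensor (N n : ℕ) (M : Matrix (Fin n → Fin N) (Fin n → Fin N) ℂ) :
    Matrix (Fin (n + 1) → Fin N) (Fin (n + 1) → Fin N) ℂ :=
  Matrix.of fun f g => if f 0 = g 0 then M (Fin.tail f) (Fin.tail g) else 0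

/-- `Id ⊗ M(λ - γ h^{(0)})` on `ℂ^N ⊗ (ℂ^N)^{⊗n}`. -/
def idTensorShift (N n : ℕ) (γ : ℂ)
    (M : (Fin N → ℂ) → Matrix (Fin n → Fin N) (Fin n → Fin N) ℂ) (lam : Fin N → ℂ) :
    Matrix (Fin (n + 1) → Fin N) (Fin (n + 1) → Fin N) ℂ :=
  Matrix.of fun f g =>
    if f 0 = g 0 then M (fun i => lam i - if g 0 = i then γ else 0) (Fin.tail f) (Fin.tail g)
    else 0

/-- The zero-weight symmetric tensor `e`: the sum of all `e_{i_1} ⊗ ⋯ ⊗ e_{i_n}` over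
sequences in which each index occurs exactly `ℓ` times. -/
def evec (N n ℓ : ℕ) : (Fin n → Fin N) → ℂ := fun f =>
  if ∀ i : Fin N, (Finset.univ.filter fun j => f j = i).card = ℓ then 1 else 0

/-- The multi-index of `ē = e_1^{⊗ℓ} ⊗ ⋯ ⊗ e_N^{⊗ℓ}`. -/
def barIdx (N ℓ : ℕ) : Fin (N * ℓ) → Fin N := fun j =>
  ⟨j.val / ℓ, by
    have h : (j : ℕ) < ℓ * N := by rw [Nat.mul_comm ℓ N]; exact j.isLt
    exact Nat.div_lt_of_lt_mul h⟩

/-- `g_{N,ℓ}(λ) = ∏_{1≤j<k≤N} ∏_{s=1}^ℓ θ(λ_j-λ_k+γs)/θ(λ_j-λ_k-γ(s-1))`. -/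
def gfun (N ℓ : ℕ) (τ γ : ℂ) (lam : Fin N → ℂ) : ℂ :=
  ∏ j : Fin N, ∏ k : Fin N,
    if j < k then
      ∏ s ∈ Finset.Icc 1 ℓ,
        theta τ (lam j - lam k + γ * (s : ℂ)) / theta τ (lam j - lam k - γ * ((s : ℂ) - 1))
    else 1

/-- The permutation induced by a word in the generators `s_1, …, s_n` of `S_{n+1}`:
`π_k = s_{a_1} ∘ ⋯ ∘ s_{a_k}` (letters `a` act as the transposition of `a` and `a+1`). -/
def permOfWord {n : ℕ} : List (Fin n) → Equiv.Perm (Fin (n + 1))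
  | [] => 1
  | a :: rest => Equiv.swap a.castSucc a.succ * permOfWord rest

/-- The product of R-matrices attached to a word (with accumulated permutation `π`):
`W_w(z,λ) = F_k ⋯ F_1` where for the `t`-th letter `a`
`F_t = R(z_{π(a)} - z_{π(a+1)}, λ - γ ∑_{b<a} h^{(π(b))})^{(π(a), π(a+1))}`,
`π = π_{t-1}` the permutation induced by the earlier letters. -/
def Wword (N : ℕ) {n : ℕ} (τ γ : ℂ) (z : Fin (n + 1) → ℂ) (lam : Fin N → ℂ) :
    List (Fin n) → Equiv.Perm (Fin (n + 1)) →
      Matrix (Fin (n + 1) → Fin N) (Fin (n + 1) → Fin N) ℂ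
  | [], _ => 1
  | a :: rest, π =>
      Wword N τ γ z lam rest (π * Equiv.swap a.castSucc a.succ) *
        Rop N (n + 1) τ γ (z (π a.castSucc) - z (π a.succ)) lam
          ((Finset.univ.filter fun c : Fin (n + 1) => (c : ℕ) < (a : ℕ)).image π)
          (π a.castSucc) (π a.succ)

/-- The fused R-matrix `𝓡_{V^{⊗m}(z), V^{⊗n}(w)}(λ)` on `(ℂ^N)^{⊗(m+n)}`
(first block: factors `0,…,m-1`; second block: factors `m,…,m+n-1`). -/
def Rmn (N m n : ℕ) (τ γ z w : ℂ) (lam : Fin N → ℂ) :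
    Matrix (Fin (m + n) → Fin N) (Fin (m + n) → Fin N) ℂ :=
  ((List.finRange m).map fun a : Fin m =>
    ((List.finRange n).map fun j : Fin n =>
      Rop N (m + n) τ γ (z + (a : ℕ) * γ - w - (j : ℕ) * γ) lam
        (Finset.univ.filter fun c : Fin (m + n) =>
          (c : ℕ) < (a : ℕ) ∨ m + (j : ℕ) < (c : ℕ))
        (Fin.castAdd n a) (Fin.natAdd m j)).prod).prod

/-- `A ⊗ B ⊆ (ℂ^N)^{⊗m} ⊗ (ℂ^N)^{⊗n}`, realised as `(A ⊗ V₂) ∩ (V₁ ⊗ B)`. -/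
def blockSub (N m n : ℕ) (A : Submodule ℂ ((Fin m → Fin N) → ℂ))
    (B : Submodule ℂ ((Fin n → Fin N) → ℂ)) :
    Submodule ℂ ((Fin (m + n) → Fin N) → ℂ) where
  carrier := {v |
    (∀ g : Fin n → Fin N, (fun f : Fin m → Fin N => v (Fin.append f g)) ∈ A) ∧
    ∀ f : Fin m → Fin N, (fun g : Fin n → Fin N => v (Fin.append f g)) ∈ B}
  add_mem' := by
    intro x y hx hy
    exact ⟨fun g => A.add_mem (hx.1 g) (hy.1 g), fun f => B.add_mem (hx.2 f) (hy.2 f)⟩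
  zero_mem' := ⟨fun _ => A.zero_mem, fun _ => B.zero_mem⟩
  smul_mem' := by
    intro c x hx
    exact ⟨fun g => A.smul_mem c (hx.1 g), fun f => B.smul_mem c (hx.2 f)⟩

/-- Matrix element `L_{jk}(z,λ)` of the `L`-operator (evaluation point `w = 0`),
as an operator on `(ℂ^N)^{⊗n}`: `L(z,λ)(e_k ⊗ v) = ∑_j e_j ⊗ L_{jk}(z,λ) v`. -/
def LmatEl (N n : ℕ) (τ γ z : ℂ) (lam : Fin N → ℂ) (j k : Fin N)
    (v : (Fin n → Fin N) → ℂ) : (Fin n → Fin N) → ℂ := fun g =>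
  (Lop N n τ γ z 0 lam).mulVec
    (fun f => (if f 0 = k then (1 : ℂ) else 0) * v (Fin.tail f)) (Fin.cons j g)

/-- `L_{j_{σ(1)} j_1}(z, λ-γ(ω_{j_2}+⋯+ω_{j_m})) ∘ ⋯ ∘ L_{j_{σ(m)} j_m}(z-(m-1)γ, λ)`. -/
def chainT (N n m : ℕ) (τ γ z : ℂ) (lam : Fin N → ℂ) (jt : Fin m → Fin N)
    (σ : Equiv.Perm (Fin m)) (v : (Fin n → Fin N) → ℂ) : (Fin n → Fin N) → ℂ :=
  (List.finRange m).foldr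
    (fun (t : Fin m) acc =>
      LmatEl N n τ γ (z - (t.val : ℂ) * γ)
        (fun i => lam i -
          γ * ((Finset.univ.filter fun s : Fin m => t < s ∧ jt s = i).card : ℂ))
        (jt (σ t)) (jt t) acc)
    v

/-- The transfer matrix `T_m(z)`, acting on scalar functions of `λ` via the identification
of the zero weight space of `S^{Nℓ}(ℂ^N)` with `ℂ` by the basis vector `e`:
`T_m(z) f(λ) = ∑_{j_1<⋯<j_m} ∑_{σ} (-1)^σ [L_{j_{σ(1)} j_1}(z,λ-γ(ω_{j_2}+⋯+ω_{j_m})) ⋯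
L_{j_{σ(m)} j_m}(z-(m-1)γ, λ)] e · f(λ-γ(ω_{j_1}+⋯+ω_{j_m}))`. -/
def Tm (N ℓ m : ℕ) (τ γ z : ℂ) (lam : Fin N → ℂ) (f : (Fin N → ℂ) → ℂ) : ℂ :=
  ∑ jt ∈ Finset.univ.filter fun jt : Fin m → Fin N => ∀ s t : Fin m, s < t → jt s < jt t,
    ∑ σ : Equiv.Perm (Fin m),
      ((Equiv.Perm.sign σ : ℤ) : ℂ) *
        chainT N (N * ℓ) m τ γ z lam jt σ (evec N (N * ℓ) ℓ) (barIdx N ℓ) *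
        f fun i => lam i - if ∃ t, jt t = i then γ else 0

/-- The `m`-th Ruijsenaars operator with coupling constant `ℓ`:
`M_m f(λ) = ∑_{|J|=m} ∏_{j∈J,k∉J} θ(λ_j-λ_k+ℓγ)/θ(λ_j-λ_k) · f(λ-γ∑_{j∈J}ω_j)`. -/
def Mm (N ℓ m : ℕ) (τ γ : ℂ) (f : (Fin N → ℂ) → ℂ) (lam : Fin N → ℂ) : ℂ :=
  ∑ J ∈ Finset.powersetCard m (Finset.univ : Finset (Fin N)),
    (∏ j ∈ J, ∏ k ∈ Jᶜ, theta τ (lam j - lam k + (ℓ : ℂ) * γ) / theta τ (lam j - lam k)) *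
      f fun i => lam i - if i ∈ J then γ else 0

/-- The transfer matrix with auxiliary space indexed by `ι` (weights `wt`) and quantum
space indexed by `ι₃`: `T f(λ) = ∑_μ tr_{W[μ]}(𝓡(λ)) f(λ-γμ)`. -/
def transferOp {N : ℕ} {ι ι₃ : Type} [Fintype ι] [Fintype ι₃] (γ : ℂ)
    (wt : ι → Fin N → ℂ) (R : (Fin N → ℂ) → Matrix (ι × ι₃) (ι × ι₃) ℂ)
    (f : (Fin N → ℂ) → ι₃ → ℂ) : (Fin N → ℂ) → ι₃ → ℂ := fun lam b =>
  ∑ a : ι, ∑ b' : ι₃, R lam (a, b) (a, b') * f (fun r => lam r - γ * wt a r) b'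


/-- The summand of a theta series with characteristic `c`. -/
def thetaCharTerm (c τ z : ℂ) (j : ℤ) : ℂ :=
  Complex.exp (Real.pi * I * (j + c) ^ 2 * τ + 2 * Real.pi * I * (j + c) * z)

lemma summable_thetaCharTerm (c z : ℂ) {τ : ℂ} (hτ : 0 < τ.im) :
    Summable (thetaCharTerm c τ z) := by
  have h := ((summable_jacobiTheta₂_term_iff (z + c * τ) τ).2 hτ).mul_left
    (Complex.exp (Real.pi * I * c ^ 2 * τ + 2 * Real.pi * I * c * z))
  refine h.congr fun j => ?_
  rw [jacobiTheta₂_term, thetaCharTerm, ← Complex.exp_add]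
  ring_nf

lemma theta_eq_neg_tsum (τ z : ℂ) :
    theta τ z = -∑' j, thetaCharTerm (1 / 2) τ (z + 1 / 2) j := rfl

lemma theta_neg (τ z : ℂ) : theta τ (-z) = -theta τ z := by
  rw [theta_eq_neg_tsum, theta_eq_neg_tsum,
    ← ((Equiv.neg ℤ).trans (Equiv.subRight (1 : ℤ))).tsum_eq
      (thetaCharTerm (1 / 2) τ (-z + 1 / 2)), ← tsum_neg (f := thetaCharTerm _ _ _)]
  congr 1
  refine tsum_congr fun j => ?_
  have h : Complex.exp (((-j - 1 : ℤ) : ℂ) * (2 * Real.pi * I) + Real.pi * I) = -1 := by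
    rw [Complex.exp_add, Complex.exp_int_mul_two_pi_mul_I, Complex.exp_pi_mul_I, one_mul]
  rw [neg_eq_neg_one_mul (thetaCharTerm _ _ _ _), ← h, thetaCharTerm, thetaCharTerm, ← Complex.exp_add]
  congr 1
  simp only [Equiv.trans_apply, Equiv.neg_apply, Equiv.subRight_apply]
  push_cast
  ring

/-- The pairs `(j, k)` of integers, split according to the parity of `j + k`. -/
def intPairParityEquiv : (ℤ × ℤ) ⊕ (ℤ × ℤ) ≃ ℤ × ℤ where
  toFun := Sum.elim (fun x => (x.1 + x.2, x.1 - x.2 - 1)) (fun x => (x.1 + x.2, x.1 - x.2))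
  invFun y := if (y.1 + y.2) % 2 = 0 then Sum.inr ((y.1 + y.2) / 2, (y.1 - y.2) / 2)
    else Sum.inl ((y.1 + y.2 + 1) / 2, (y.1 - y.2 - 1) / 2)
  left_inv := by
    rintro (⟨p, q⟩ | ⟨p, q⟩)
    · have h : ¬ (p + q + (p - q - 1)) % 2 = 0 := by omega
      simp only [Sum.elim_inl, h, if_false, Sum.inl.injEq, Prod.mk.injEq]
      omega
    · have h : (p + q + (p - q)) % 2 = 0 := by omega
      simp only [Sum.elim_inr, h, if_true, Sum.inr.injEq, Prod.mk.injEq]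
      omega
  right_inv := by
    rintro ⟨j, k⟩
    by_cases h : (j + k) % 2 = 0
    · simp only [if_pos h, Sum.elim_inr, Prod.mk.injEq]
      omega
    · simp only [if_neg h, Sum.elim_inl, Prod.mk.injEq]
      omega

lemma theta_add_mul_theta_sub {τ : ℂ} (hτ : 0 < τ.im) (x y : ℂ) :
    theta τ (x + y) * theta τ (x - y) =
      (∑' j, thetaCharTerm 0 (2 * τ) (2 * x) j) * (∑' j, thetaCharTerm (1 / 2) (2 * τ) (2 * y) j) -
      (∑' j, thetaCharTerm (1 / 2) (2 * τ) (2 * x) j) *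
        (∑' j, thetaCharTerm 0 (2 * τ) (2 * y) j) := by
  have hτ' : 0 < (2 * τ).im := by simpa using hτ
  have hprod {c d u v σ : ℂ} (hσ : 0 < σ.im) :
      HasSum (fun a : ℤ × ℤ => thetaCharTerm c σ u a.1 * thetaCharTerm d σ v a.2)
        ((∑' j, thetaCharTerm c σ u j) * ∑' j, thetaCharTerm d σ v j) :=
    (summable_thetaCharTerm c u hσ).hasSum.mul (summable_thetaCharTerm d v hσ).hasSum
      (summable_mul_of_summable_norm (summable_thetaCharTerm c u hσ).norm
        (summable_thetaCharTerm d v hσ).norm)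
  rw [theta_eq_neg_tsum, theta_eq_neg_tsum, neg_mul_neg, sub_eq_add_neg (_ * _)]
  refine (intPairParityEquiv.hasSum_iff.2 (hprod hτ)).unique (HasSum.sum ?_ ?_)
  · convert! hprod (c := 0) (d := 1 / 2) (u := 2 * x) (v := 2 * y) hτ' using 1
    funext ⟨p, q⟩
    have h (w : ℂ) : Complex.exp (p * (2 * Real.pi * I)) * w = w := by
      rw [Complex.exp_int_mul_two_pi_mul_I, one_mul]
    rw [← h (thetaCharTerm 0 _ _ _ * _)]
    simp only [Function.comp_apply, intPairParityEquiv, Equiv.coe_fn_mk, Sum.elim_inl,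
      thetaCharTerm, ← Complex.exp_add]
    push_cast
    ring_nf
  · convert! (hprod (c := 1 / 2) (d := 0) (u := 2 * x) (v := 2 * y) hτ').neg using 1
    funext ⟨p, q⟩
    have h : Complex.exp (p * (2 * Real.pi * I) + Real.pi * I) = -1 := by
      rw [Complex.exp_add, Complex.exp_int_mul_two_pi_mul_I, Complex.exp_pi_mul_I, one_mul]
    rw [neg_eq_neg_one_mul, ← h]
    simp only [Function.comp_apply, intPairParityEquiv, Equiv.coe_fn_mk, Sum.elim_inr,
      thetaCharTerm, ← Complex.exp_add]
    push_cast
    ring_nf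

/-- The three-term addition formula of Weierstrass. -/
lemma theta_three_term {τ : ℂ} (hτ : 0 < τ.im) (x y z : ℂ) :
    theta τ x ^ 2 * (theta τ (y + z) * theta τ (y - z)) +
      theta τ (x + y) * theta τ (x - y) * theta τ z ^ 2 =
      theta τ (x + z) * theta τ (x - z) * theta τ y ^ 2 := by
  have hsq (w : ℂ) : theta τ w ^ 2 = theta τ (w + 0) * theta τ (w - 0) := by
    rw [add_zero, sub_zero, sq]
  rw [hsq x, hsq y, hsq z]
  simp only [theta_add_mul_theta_sub hτ]
  ring

lemma alphaF_mul_add_betaF_mul {τ γ z μ : ℂ} (hτ : 0 < τ.im) (hz : theta τ (z - γ) ≠ 0)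
    (hz' : theta τ (-z - γ) ≠ 0) (hμ : theta τ μ ≠ 0) :
    alphaF τ γ z μ * alphaF τ γ (-z) (-μ) + betaF τ γ z μ * betaF τ γ (-z) μ = 1 := by
  have h := theta_three_term hτ z μ γ
  have e1 : theta τ (-z - γ) = -theta τ (z + γ) := by rw [← theta_neg]; ring_nf
  have e2 : theta τ (-μ + γ) = -theta τ (μ - γ) := by rw [← theta_neg]; ring_nf
  have e3 : theta τ (-z + μ) = -theta τ (z - μ) := by rw [← theta_neg]; ring_nf
  rw [e1, neg_ne_zero] at hz'
  simp only [alphaF, betaF, e1, e2, e3, theta_neg]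
  field_simp
  linear_combination h

lemma alphaF_mul_betaF_add {τ γ z μ : ℂ} :
    alphaF τ γ z μ * betaF τ γ (-z) (-μ) + betaF τ γ z μ * alphaF τ γ (-z) μ = 0 := by
  have e : theta τ (-z + -μ) = -theta τ (z + μ) := by rw [← theta_neg]; ring_nf
  simp only [alphaF, betaF, e, theta_neg]
  ring

/-- unitarity `R(z,λ) R(-z,λ)^{(21)} = Id`. -/
theorem R_unitarity (N : ℕ) (hN : 2 ≤ N) (τ : ℂ) (hτ : 0 < τ.im) (γ z : ℂ)
    (lam : Fin N → ℂ)
    (hz : theta τ (z - γ) ≠ 0) (hz' : theta τ (-z - γ) ≠ 0)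
    (hlam : ∀ i j : Fin N, i ≠ j → theta τ (lam i - lam j) ≠ 0) :
    Rmat N τ γ z lam *
        Matrix.of (fun p q : Fin N × Fin N => Rmat N τ γ (-z) lam (p.2, p.1) (q.2, q.1)) =
      1 := by
  ext ⟨i, j⟩ ⟨k, l⟩
  by_cases hij : i = j
  · subst hij
    have hrow (M : Matrix (Fin N × Fin N) (Fin N × Fin N) ℂ) :
        (Rmat N τ γ z lam * M) (i, i) (k, l) = M (i, i) (k, l) := by
      simp [Matrix.mul_apply, Rmat]
    rw [hrow]
    simp [Rmat, Matrix.one_apply, and_comm, eq_comm]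
  · have hd := alphaF_mul_add_betaF_mul hτ hz hz' (hlam i j hij)
    have ho := alphaF_mul_betaF_add (τ := τ) (γ := γ) (z := z) (μ := lam i - lam j)
    rw [neg_sub] at hd ho
    have hrow (M : Matrix (Fin N × Fin N) (Fin N × Fin N) ℂ) :
        (Rmat N τ γ z lam * M) (i, j) (k, l) =
          alphaF τ γ z (lam i - lam j) * M (i, j) (k, l) +
            betaF τ γ z (lam i - lam j) * M (j, i) (k, l) := by
      simp [Matrix.mul_apply, Rmat, hij, add_mul, Finset.sum_add_distrib]
    rw [hrow]
    simp only [Matrix.of_apply, Rmat, hij, Ne.symm hij, if_false, Matrix.one_apply, Prod.mk.injEq]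
    by_cases h1 : k = i ∧ l = j
    · obtain ⟨rfl, rfl⟩ := h1
      simpa [hij, Ne.symm hij] using hd
    · by_cases h2 : k = j ∧ l = i
      · obtain ⟨rfl, rfl⟩ := h2
        simpa [hij, Ne.symm hij] using ho
      · grind

end EllipticQG
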